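/- Let ς be any real-valued functional on bounded Lebesgue-measurable functions on [0,1] that is monotone (f ≤ g pointwise implies ς(f) ≤ ς(g)) and translation invariant for constants (ς(f + c) = ς(f) + c for all real c). Then the Bellman operator built from ς is a γ-contraction: for all bounded U, V : S → ℝ such that all compositions w ↦ U(T(s,a,w)) and w ↦ V(T(s,a,w)) are Lebesgue-measurable, sup_{s∈S} |(BU)(s) − (BV)(s)| ≤ γ · sup_{s∈S} |U(s) − V(s)|. -/

import Mathlib

open MeasureTheory Set Filter

/-- Lebesgue measure on the unit interval `[0,1]`. -/
noncomputable def leb01 : Measure ℝ := volume.restrict (Icc (0 : ℝ) 1)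

/-- A bounded real-valued function. -/
def Bdd {α : Type*} (f : α → ℝ) : Prop := ∃ C : ℝ, ∀ x, |f x| ≤ C

/-- `M` is a risk envelope: a nonempty set of (Lebesgue-)measurable probability densities on
`[0,1]`, i.e. `Q ≥ 0` a.e. and `∫₀¹ Q(w) dw = 1`. -/
def IsRiskEnvelope (M : Set (ℝ → ℝ)) : Prop :=
  M.Nonempty ∧ ∀ Q ∈ M, AEMeasurable Q leb01 ∧ (0 ≤ᵐ[leb01] Q) ∧ ∫ w, Q w ∂leb01 = 1

/-- The dual-form risk mapping `ς(f) = inf_{Q ∈ M} ∫₀¹ f(w) Q(w) dw`. -/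
noncomputable def dualRisk (M : Set (ℝ → ℝ)) (f : ℝ → ℝ) : ℝ :=
  ⨅ Q : M, ∫ w, f w * (Q : ℝ → ℝ) w ∂leb01

/-- The Bellman operator `(BV)(s) = sup_{a ∈ A(s)} [ r(s,a) + γ · ς(V(T(s,a,·))) ]`, built from
a risk mapping `ς`. -/
noncomputable def bellman {S A : Type*} (ς : (ℝ → ℝ) → ℝ) (Aset : S → Set A)
    (T : S → A → ℝ → S) (r : S → A → ℝ) (γ : ℝ) (V : S → ℝ) : S → ℝ :=
  fun s => ⨆ a : Aset s, (r s a + γ * ς fun w => V (T s a w))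

/-- For any monotone, translation-invariant real-valued functional `ς` on
bounded measurable functions on `[0,1]`, the Bellman operator built from `ς` is a
`γ`-contraction with respect to the sup norm. -/
theorem bellman_contraction_general
    {S A : Type*} [Nonempty S] [Nonempty A]
    (ς : (ℝ → ℝ) → ℝ)
    (hς_mono : ∀ f g : ℝ → ℝ, Bdd f → AEMeasurable f leb01 → Bdd g → AEMeasurable g leb01 →
      (∀ w ∈ Icc (0 : ℝ) 1, f w ≤ g w) → ς f ≤ ς g)
    (hς_trans : ∀ (f : ℝ → ℝ) (c : ℝ), Bdd f → AEMeasurable f leb01 →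
      ς (fun w => f w + c) = ς f + c)
    (Aset : S → Set A) (hA : ∀ s, (Aset s).Nonempty)
    (T : S → A → ℝ → S)
    (r : S → A → ℝ) (hr : Bdd fun p : S × A => r p.1 p.2)
    (γ : ℝ) (hγ0 : 0 ≤ γ) (hγ1 : γ < 1)
    (U V : S → ℝ) (hU : Bdd U) (hV : Bdd V)
    (hU_meas : ∀ s : S, ∀ a ∈ Aset s, AEMeasurable (fun w => U (T s a w)) leb01)
    (hV_meas : ∀ s : S, ∀ a ∈ Aset s, AEMeasurable (fun w => V (T s a w)) leb01) :
    (⨆ s : S, |bellman ς Aset T r γ U s - bellman ς Aset T r γ V s|)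
      ≤ γ * ⨆ s : S, |U s - V s| := by
  obtain ⟨CU, hCU⟩ := hU
  obtain ⟨CV, hCV⟩ := hV
  obtain ⟨Cr, hCr⟩ := hr
  have key : ∀ (f g : ℝ → ℝ) (c : ℝ), Bdd f → AEMeasurable f leb01 → Bdd g →
      AEMeasurable g leb01 → (∀ w, f w ≤ g w + c) → ς f ≤ ς g + c := by
    intro f g c hf hfm hg hgm h
    rw [← hς_trans g c hg hgm]
    refine hς_mono _ _ hf hfm ?_ (hgm.add_const c) (fun w _ => h w)
    obtain ⟨C, hC⟩ := hg
    exact ⟨C + |c|, fun w => (abs_add_le _ _).trans (by linarith [hC w])⟩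
  -- boundedness of the family defining the Bellman operator
  have bdd : ∀ (W : S → ℝ) (C : ℝ), (∀ s, |W s| ≤ C) →
      (∀ s : S, ∀ a ∈ Aset s, AEMeasurable (fun w => W (T s a w)) leb01) → ∀ s,
      BddAbove (range fun a : Aset s => r s a + γ * ς fun w => W (T s a w)) := by
    intro W C hC hm s
    refine ⟨Cr + γ * (ς (fun _ => 0) + C), ?_⟩
    rintro _ ⟨a, rfl⟩
    have h1 := key (fun w => W (T s a w)) (fun _ => 0) C ⟨C, fun w => hC _⟩ (hm s a a.2)
      ⟨0, fun _ => by simp⟩ aemeasurable_const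
      (fun w => by linarith [le_abs_self (W (T s a w)), hC (T s a w)])
    have h2 := mul_le_mul_of_nonneg_left h1 hγ0
    have h3 := (le_abs_self _).trans (hCr (s, (a : A)))
    simp only at h3
    exact add_le_add h3 h2
  have hD : BddAbove (range fun s => |U s - V s|) := by
    refine ⟨CU + CV, ?_⟩
    rintro _ ⟨s, rfl⟩
    exact (abs_sub _ _).trans (add_le_add (hCU s) (hCV s))
  have one : ∀ (W X : S → ℝ) (C C' D : ℝ), (∀ s, |W s| ≤ C) → (∀ s, |X s| ≤ C') →
      (∀ s : S, ∀ a ∈ Aset s, AEMeasurable (fun w => W (T s a w)) leb01) →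
      (∀ s : S, ∀ a ∈ Aset s, AEMeasurable (fun w => X (T s a w)) leb01) →
      (∀ s, W s ≤ X s + D) → ∀ s,
      bellman ς Aset T r γ W s ≤ bellman ς Aset T r γ X s + γ * D := by
    intro W X C C' D hW hX hWm hXm h s
    have : Nonempty (Aset s) := (hA s).to_subtype
    refine ciSup_le fun a => ?_
    have h1 := key (fun w => W (T s a w)) (fun w => X (T s a w)) D ⟨C, fun w => hW _⟩
      (hWm s a a.2) ⟨C', fun w => hX _⟩ (hXm s a a.2) (fun w => h _)
    have h2 := mul_le_mul_of_nonneg_left h1 hγ0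
    have h3 : (r s a + γ * ς fun w => X (T s a w)) ≤ bellman ς Aset T r γ X s :=
      le_ciSup (bdd X C' hX hXm s) a
    linarith
  refine ciSup_le fun s => ?_
  have hUV : ∀ s, |U s - V s| ≤ ⨆ s : S, |U s - V s| := fun s => le_ciSup hD s
  have h1 := one U V CU CV (⨆ s : S, |U s - V s|) hCU hCV hU_meas hV_meas
    (fun s => by linarith [(abs_le.1 (hUV s)).2]) s
  have h2 := one V U CV CU (⨆ s : S, |U s - V s|) hCV hCU hV_meas hU_meas
    (fun s => by linarith [(abs_le.1 (hUV s)).1]) s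
  rw [abs_le]
  constructor <;> linarith
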